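/- Fix n ≥ 3, w ∈ S_n, and k ∈ {2,…,n−1}. If w(k−1) > w(k) > w(k+1), then w has a reduced decomposition containing three consecutive factors equal to σ_k σ_{k−1} σ_k, and consequently max_k(w) > min_k(w). -/

import Mathlib

/-- The simple reflection `σ_i = (i, i+1)`, acting on `ℕ` (1-indexed positions/values). -/
def simpleRefl (i : ℕ) : Equiv.Perm ℕ := Equiv.swap i (i + 1)

/-- `w` is a permutation of `{1, …, n}`: it fixes every point outside `[1, n]`. -/
def IsPermOf (n : ℕ) (w : Equiv.Perm ℕ) : Prop :=
  ∀ x : ℕ, x ∉ Finset.Icc 1 n → w x = x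

/-- The Coxeter length of `w`: its number of inversions on `{1, …, n}`. -/
def len (n : ℕ) (w : Equiv.Perm ℕ) : ℕ :=
  ((Finset.Icc 1 n ×ˢ Finset.Icc 1 n).filter fun p => p.1 < p.2 ∧ w p.2 < w p.1).card

/-- `L` is a word for `w`: a list of indices in `[1, n-1]` whose associated product of
simple reflections (read left to right) is `w`. -/
def IsWord (n : ℕ) (w : Equiv.Perm ℕ) (L : List ℕ) : Prop :=
  (∀ i ∈ L, 1 ≤ i ∧ i ≤ n - 1) ∧ (L.map simpleRefl).prod = w

/-- `L` is a reduced decomposition of `w`. -/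
def IsReducedWord (n : ℕ) (w : Equiv.Perm ℕ) (L : List ℕ) : Prop :=
  IsWord n w L ∧ L.length = len n w

/-- `min_k(w)`: the minimum number of occurrences of `σ_k` in a reduced decomposition of `w`. -/
noncomputable def minOcc (n k : ℕ) (w : Equiv.Perm ℕ) : ℕ :=
  sInf {m | ∃ L : List ℕ, IsReducedWord n w L ∧ L.count k = m}

/-- `max_k(w)`: the maximum number of occurrences of `σ_k` in a reduced decomposition of `w`. -/
noncomputable def maxOcc (n k : ℕ) (w : Equiv.Perm ℕ) : ℕ :=
  sSup {m | ∃ L : List ℕ, IsReducedWord n w L ∧ L.count k = m}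

/-- `expat_k(w) = |{w(1),…,w(k)} ∩ {k+1,…,n}|`. -/
def expat (n k : ℕ) (w : Equiv.Perm ℕ) : ℕ :=
  (((Finset.Icc 1 k).image fun i => w i) ∩ Finset.Icc (k + 1) n).card

/-- A `321`-pattern of `w` in positions `i1 < i2 < i3` (within `[1, n]`). -/
def Is321At (n : ℕ) (w : Equiv.Perm ℕ) (i1 i2 i3 : ℕ) : Prop :=
  1 ≤ i1 ∧ i1 < i2 ∧ i2 < i3 ∧ i3 ≤ n ∧ w i3 < w i2 ∧ w i2 < w i1

/-- A `3412`-pattern of `w` in positions `i1 < i2 < i3 < i4` (within `[1, n]`). -/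
def Is3412At (n : ℕ) (w : Equiv.Perm ℕ) (i1 i2 i3 i4 : ℕ) : Prop :=
  1 ≤ i1 ∧ i1 < i2 ∧ i2 < i3 ∧ i3 < i4 ∧ i4 ≤ n ∧
    w i3 < w i4 ∧ w i4 < w i1 ∧ w i1 < w i2

/-- `p` is a position pair at `k`: `p = (i1, i3)` for a `321`-pattern with `i1 ≤ k < i3`,
or `p = (i2, i3)` for a `3412`-pattern with `i2 ≤ k < i3`. -/
def IsPosPair (n k : ℕ) (w : Equiv.Perm ℕ) (p : ℕ × ℕ) : Prop :=
  (∃ i2, Is321At n w p.1 i2 p.2 ∧ p.1 ≤ k ∧ k < p.2) ∨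
  (∃ i1 i4, Is3412At n w i1 p.1 p.2 i4 ∧ p.1 ≤ k ∧ k < p.2)

/-- `p` is a value pair at `k`: `p = (j3, j1)` for a `321`-pattern with values
`j1 < j2 < j3` and `j1 ≤ k < j3`, or `p = (j4, j1)` for a `3412`-pattern with values
`j1 < j2 < j3 < j4` and `j2 ≤ k < j3`. -/
def IsValPair (n k : ℕ) (w : Equiv.Perm ℕ) (p : ℕ × ℕ) : Prop :=
  (∃ i1 i2 i3, Is321At n w i1 i2 i3 ∧ w i3 ≤ k ∧ k < w i1 ∧ p = (w i1, w i3)) ∨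
  (∃ i1 i2 i3 i4, Is3412At n w i1 i2 i3 i4 ∧ w i4 ≤ k ∧ k < w i1 ∧ p = (w i2, w i3))

/-- `PosPair_k(w)`: the number of distinct position pairs at `k` in `w`. -/
noncomputable def posPairCount (n k : ℕ) (w : Equiv.Perm ℕ) : ℕ :=
  Set.ncard {p : ℕ × ℕ | IsPosPair n k w p}

/-- `ValPair_k(w)`: the number of distinct value pairs at `k` in `w`. -/
noncomputable def valPairCount (n k : ℕ) (w : Equiv.Perm ℕ) : ℕ :=
  Set.ncard {p : ℕ × ℕ | IsValPair n k w p}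

theorem aux_perm_mul (n : ℕ) (w : Equiv.Perm ℕ) (hw : IsPermOf n w) (i : ℕ) (h1 : 1 ≤ i)
    (h2 : i + 1 ≤ n) : IsPermOf n (w * simpleRefl i) := by
  intro x hx
  have hx' := hx
  rw [Finset.mem_Icc] at hx'
  have : simpleRefl i x = x := by
    unfold simpleRefl
    apply Equiv.swap_apply_of_ne_of_ne <;> omega
  rw [Equiv.Perm.mul_apply, this]
  exact hw x hx

theorem aux_refl_cases (i x : ℕ) : (x = i ∧ simpleRefl i x = i + 1) ∨
    (x = i + 1 ∧ simpleRefl i x = i) ∨ (x ≠ i ∧ x ≠ i + 1 ∧ simpleRefl i x = x) := by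
  unfold simpleRefl
  rw [Equiv.swap_apply_def]
  split_ifs <;> omega

theorem aux_refl_invol (i x : ℕ) : simpleRefl i (simpleRefl i x) = x := by
  unfold simpleRefl
  rw [← Equiv.Perm.mul_apply, Equiv.swap_mul_self, Equiv.Perm.one_apply]

theorem aux_len (n : ℕ) (w : Equiv.Perm ℕ) (i : ℕ) (h1 : 1 ≤ i)
    (h2 : i + 1 ≤ n) (hd : w (i + 1) < w i) : len n w = len n (w * simpleRefl i) + 1 := by
  unfold len
  set S := ((Finset.Icc 1 n ×ˢ Finset.Icc 1 n).filter fun p => p.1 < p.2 ∧ w p.2 < w p.1) with hS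
  have hmem : (i, i + 1) ∈ S := by
    simp only [hS, Finset.mem_filter, Finset.mem_product, Finset.mem_Icc]
    refine ⟨⟨⟨?_, ?_⟩, ?_, ?_⟩, ?_, hd⟩ <;> omega
  rw [← Finset.card_erase_add_one hmem]
  congr 1
  apply Finset.card_bij' (fun p _ => (simpleRefl i p.1, simpleRefl i p.2))
    (fun p _ => (simpleRefl i p.1, simpleRefl i p.2))
  · rintro ⟨a, b⟩ h
    simp only [hS, Finset.mem_erase, Finset.mem_filter, Finset.mem_product, Finset.mem_Icc, ne_eq,
      Prod.mk.injEq] at h ⊢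
    simp only [Equiv.Perm.mul_apply, aux_refl_invol]
    obtain ⟨h0, h3, h4, h5⟩ := h
    have := aux_refl_cases i a
    have := aux_refl_cases i b
    refine ⟨?_, ?_, h5⟩ <;> omega
  · rintro ⟨a, b⟩ h
    simp only [hS, Finset.mem_erase, Finset.mem_filter, Finset.mem_product, Finset.mem_Icc, ne_eq,
      Prod.mk.injEq] at h ⊢
    simp only [Equiv.Perm.mul_apply] at h
    obtain ⟨h3, h4, h5⟩ := h
    have ha := aux_refl_cases i a
    have hb := aux_refl_cases i b
    have key : ¬ (a = i ∧ b = i + 1) := by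
      rintro ⟨rfl, rfl⟩
      have e1 : simpleRefl a a = a + 1 := by omega
      have e2 : simpleRefl a (a + 1) = a := by omega
      rw [e1, e2] at h5
      omega
    refine ⟨?_, ?_, ?_, h5⟩ <;> omega
  · rintro ⟨a, b⟩ h
    simp only [aux_refl_invol]
  · rintro ⟨a, b⟩ h
    simp only [aux_refl_invol]

theorem aux_id (n : ℕ) (w : Equiv.Perm ℕ) (hw : IsPermOf n w)
    (h : ∀ i, 1 ≤ i → i + 1 ≤ n → ¬ w (i + 1) < w i) : w = 1 := by
  have hout : ∀ x, ¬ (1 ≤ x ∧ x ≤ n) → w x = x := fun x hx =>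
    hw x (by rw [Finset.mem_Icc]; exact hx)
  have hm : StrictMono w := by
    apply strictMono_nat_of_lt_succ
    intro i
    have hne : w i ≠ w (i + 1) := fun e => by
      have := w.injective e
      omega
    by_cases h1 : 1 ≤ i ∧ i + 1 ≤ n
    · have := h i h1.1 h1.2
      omega
    · by_cases h0 : i = 0
      · subst h0
        have := hout 0 (by omega)
        omega
      · have e := hout (i + 1) (by omega)
        by_contra hlt
        have e2 := hout (w i) (by omega)
        have := w.injective e2
        omega
  have hm' : StrictMono w.symm := by
    intro a b hab
    apply hm.lt_iff_lt.1
    simpa using hab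
  ext x
  have a1 := hm.le_apply (x := x)
  have a2 := hm.monotone (hm'.le_apply (x := x))
  simp only [Equiv.apply_symm_apply] at a2
  rw [Equiv.Perm.one_apply]
  omega

theorem aux_exists (n m : ℕ) : ∀ w : Equiv.Perm ℕ, IsPermOf n w → len n w = m →
    ∃ L, IsReducedWord n w L := by
  induction m with
  | zero =>
    intro w hw hl
    have : w = 1 := by
      apply aux_id n w hw
      intro i h1 h2 hd
      have := aux_len n w i h1 h2 hd
      omega
    refine ⟨[], ⟨by simp, ?_⟩, by simp [hl]⟩
    simp [this]
  | succ m ih =>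
    intro w hw hl
    by_cases h : ∀ i, 1 ≤ i → i + 1 ≤ n → ¬ w (i + 1) < w i
    · have := aux_id n w hw h
      subst this
      refine ⟨[], ⟨by simp, by simp⟩, ?_⟩
      unfold len
      symm
      rw [List.length_nil, Finset.card_eq_zero, Finset.filter_eq_empty_iff]
      intro p _
      simp only [Equiv.Perm.one_apply]
      omega
    · push Not at h
      obtain ⟨i, h1, h2, hd⟩ := h
      have e := aux_len n w i h1 h2 hd
      obtain ⟨L, ⟨hL1, hL2⟩, hL3⟩ := ih _ (aux_perm_mul n w hw i h1 h2) (by omega)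
      refine ⟨L ++ [i], ⟨?_, ?_⟩, ?_⟩
      · intro j hj
        rw [List.mem_append, List.mem_singleton] at hj
        rcases hj with hj | rfl
        · exact hL1 j hj
        · omega
      · rw [List.map_append, List.prod_append, hL2]
        ext x
        simp [aux_refl_invol]
      · rw [List.length_append, hL3, e, List.length_singleton]

theorem aux_refl_l (i : ℕ) : simpleRefl i i = i + 1 := Equiv.swap_apply_left _ _

theorem aux_refl_r (i : ℕ) : simpleRefl i (i + 1) = i := Equiv.swap_apply_right _ _

theorem aux_refl_o (i x : ℕ) (h : x ≠ i) (h' : x ≠ i + 1) : simpleRefl i x = x :=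
  Equiv.swap_apply_of_ne_of_ne h h'

theorem aux_braid (j : ℕ) (x : ℕ) :
    simpleRefl j (simpleRefl (j + 1) (simpleRefl j x)) =
    simpleRefl (j + 1) (simpleRefl j (simpleRefl (j + 1) x)) := by
  unfold simpleRefl
  simp only [Equiv.swap_apply_def]
  split_ifs <;> omega

/-- If `w(k-1) > w(k) > w(k+1)` (for `2 ≤ k ≤ n-1`), then `w` has a
reduced decomposition containing the consecutive factors `σ_k σ_{k-1} σ_k`, and
consequently `max_k(w) > min_k(w)`. -/
theorem braid_infix_of_descents (n : ℕ) (hn : 3 ≤ n) (w : Equiv.Perm ℕ)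
    (hw : IsPermOf n w) (k : ℕ) (hk1 : 2 ≤ k) (hk2 : k ≤ n - 1)
    (hdesc : w (k + 1) < w k ∧ w k < w (k - 1)) :
    (∃ L : List ℕ, IsReducedWord n w L ∧ [k, k - 1, k] <:+: L) ∧
    minOcc n k w < maxOcc n k w := by
  obtain ⟨j, rfl⟩ : ∃ j, k = j + 1 := ⟨k - 1, by omega⟩
  simp only [Nat.add_sub_cancel] at hdesc ⊢
  obtain ⟨hd1, hd2⟩ := hdesc
  have e1 := aux_len n w (j + 1) (by omega) (by omega) hd1
  have p1 := aux_perm_mul n w hw (j + 1) (by omega) (by omega)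
  have o1 : simpleRefl (j + 1) j = j := aux_refl_o _ _ (by omega) (by omega)
  have o2 : simpleRefl j (j + 1 + 1) = j + 1 + 1 := aux_refl_o _ _ (by omega) (by omega)
  have e2 := aux_len n _ j (by omega) (by omega)
    (show (w * simpleRefl (j + 1)) (j + 1) < (w * simpleRefl (j + 1)) j by
      simp only [Equiv.Perm.mul_apply, aux_refl_l, o1]
      omega)
  have p2 := aux_perm_mul n _ p1 j (by omega) (by omega)
  have e3 := aux_len n _ (j + 1) (by omega) (by omega)
    (show (w * simpleRefl (j + 1) * simpleRefl j) (j + 1 + 1)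
        < (w * simpleRefl (j + 1) * simpleRefl j) (j + 1) by
      simp only [Equiv.Perm.mul_apply, aux_refl_l, aux_refl_r, o1, o2]
      omega)
  have p3 := aux_perm_mul n _ p2 (j + 1) (by omega) (by omega)
  obtain ⟨L, ⟨hL1, hL2⟩, hL3⟩ := aux_exists n _ _ p3 rfl
  have r1 : IsReducedWord n w (L ++ [j + 1, j, j + 1]) := by
    refine ⟨⟨?_, ?_⟩, ?_⟩
    · intro i hi
      simp only [List.mem_append, List.mem_cons, List.not_mem_nil, or_false] at hi
      rcases hi with hi | hi
      · exact hL1 i hi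
      · omega
    · rw [List.map_append, List.prod_append, hL2]
      ext x
      simp [aux_refl_invol]
    · rw [List.length_append, hL3, e1, e2, e3]
      rfl
  have r2 : IsReducedWord n w (L ++ [j, j + 1, j]) := by
    refine ⟨⟨?_, ?_⟩, ?_⟩
    · intro i hi
      simp only [List.mem_append, List.mem_cons, List.not_mem_nil, or_false] at hi
      rcases hi with hi | hi
      · exact hL1 i hi
      · omega
    · rw [List.map_append, List.prod_append, hL2]
      ext x
      simp [aux_braid, aux_refl_invol]
    · rw [List.length_append, hL3, e1, e2, e3]
      rfl
  refine ⟨⟨_, r1, ⟨L, [], by simp⟩⟩, ?_⟩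
  have hmin : minOcc n (j + 1) w ≤ L.count (j + 1) + 1 := by
    apply Nat.sInf_le
    refine ⟨_, r2, ?_⟩
    simp [List.count_append, List.count_cons]
  have hmax : L.count (j + 1) + 2 ≤ maxOcc n (j + 1) w := by
    apply le_csSup
    · refine ⟨len n w, ?_⟩
      rintro m ⟨L', hL', rfl⟩
      rw [← hL'.2]
      exact List.count_le_length
    · refine ⟨_, r1, ?_⟩
      simp [List.count_append, List.count_cons]
  omega
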